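/- Let β > 1 and set C'_β = ((3+β)/2)·Σ_{i=0}^∞ (2i+1)·β^{-i}. For every k ≥ 1 and every corner point z of an order-k branch of the fractal configuration ξ, the β-biased random walk on ξ that takes a step to the left from z (i.e., is started at the main-part vertex immediately to the left of z) returns to z in expected time at most C'_β; that is, 1 plus the expected hitting time of z for the walk started at the left neighbor of z is at most C'_β. -/

import Mathlib

open MeasureTheory Filter
open scoped ENNReal

noncomputable section

/-- Vertices of the square lattice. -/
abbrev V : Type := ℤ × ℤ

/-- Adjacency in the square lattice ℤ²: Euclidean distance one. -/
def latAdj (u v : V) : Prop := (u.1 - v.1) ^ 2 + (u.2 - v.2) ^ 2 = 1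

instance : MeasurableSpace (Sym2 V) := ⊤

open scoped Classical in
/-- One-step transition probability of the β-biased random walk on the subgraph of ℤ²
with edge set `G`: if the set `Λ` of neighbours of `z` is nonempty and contains the right
neighbour `(z.1+1, z.2)`, step to it with probability `β/(β+|Λ|-1)` and to each other
neighbour with probability `1/(β+|Λ|-1)`; if `Λ` does not contain the right neighbour, step
uniformly in `Λ`; if `Λ` is empty, stay put. -/
def transProb (β : ℝ) (G : Set (Sym2 V)) (z w : V) : ℝ :=
  if {u : V | s(z, u) ∈ G} = ∅ then (if w = z then 1 else 0)
  else
    if s(z, w) ∈ G then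
      (if s(z, ((z.1 + 1, z.2) : V)) ∈ G then
        (if w = ((z.1 + 1, z.2) : V) then
          β / (β + ({u : V | s(z, u) ∈ G}.ncard : ℝ) - 1)
        else 1 / (β + ({u : V | s(z, u) ∈ G}.ncard : ℝ) - 1))
      else 1 / ({u : V | s(z, u) ∈ G}.ncard : ℝ))
    else 0

/-- `μ` is the law of the β-biased random walk on the subgraph of ℤ² with edge set `G`,
started at `z₀`: a probability measure on trajectories whose cylinder probabilities are
the products of the one-step transition probabilities. -/
def IsWalkLaw (β : ℝ) (G : Set (Sym2 V)) (z₀ : V) (μ : Measure (ℕ → V)) : Prop :=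
  IsProbabilityMeasure μ ∧
    ∀ (n : ℕ) (f : ℕ → V), f 0 = z₀ →
      μ {ω | ∀ i ≤ n, ω i = f i} =
        ENNReal.ofReal (∏ i ∈ Finset.range n, transProb β G (f i) (f (i + 1)))

/-- `b_k = 4 · 3^{k(k-1)/2}`. -/
def bF (k : ℕ) : ℕ := 4 * 3 ^ (k * (k - 1) / 2)

/-- `q_k = 3^k - 1`. -/
def qF (k : ℕ) : ℕ := 3 ^ k - 1

open scoped Classical in
/-- Direction of the abutment of a branch on row index `l` (odd): `+1` if `(l+1)/2` is odd
(so that the root lands on a row reserved for branches of the next order), `-1` otherwise. -/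
def dirF (l : ℤ) : ℤ := if Odd ((l + 1) / 2) then 1 else -1

/-- The set of x-coordinates of tips of order-`k` branches of the fractal configuration:
`0` is a tip of every order, and if `x` is an order-`(k+1)` tip then `x + (j-1)·b_k` is an
order-`k` tip for every `1 ≤ j ≤ q_k` (the order-`k` branches attached to the order-`(k+1)`
branch with tip `x` have their roots at `x + j·b_k - 1`, hence their tips at `x + (j-1)·b_k`). -/
inductive IsTip : ℕ → ℤ → Prop
  | zero (k : ℕ) : IsTip k 0
  | step (k : ℕ) (x : ℤ) (j : ℕ) : IsTip (k + 1) x → 1 ≤ j → j ≤ qF k →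
      IsTip k (x + ((j : ℤ) - 1) * (bF k : ℤ))

/-- The y-coordinate of the row with index `l` reserved for order-`k` branches:
`y = 3 · 2^{k-1} · l` (`l` odd). -/
def rowY (k : ℕ) (l : ℤ) : ℤ := 3 * 2 ^ (k - 1) * l

/-- The fractal configuration ξ: for every order `k ≥ 1`, every odd `l` and every order-`k`
tip `x`, the main part of the branch (the `b_k - 1` horizontal edges from the tip
`(x, 3·2^{k-1}·l)` to the corner `(x + b_k - 1, 3·2^{k-1}·l)`) together with its abutment
(the `3·2^{k-1}` vertical edges from the corner to the root, in the direction `dirF l`). -/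
def xiEdges : Set (Sym2 V) :=
  {f | ∃ (k : ℕ) (l x : ℤ), 1 ≤ k ∧ Odd l ∧ IsTip k x ∧
    ((∃ i : ℕ, i + 2 ≤ bF k ∧
        f = s((x + i, rowY k l), (x + i + 1, rowY k l))) ∨
      (∃ j : ℕ, j < 3 * 2 ^ (k - 1) ∧
        f = s((x + bF k - 1, rowY k l + dirF l * j),
              (x + bF k - 1, rowY k l + dirF l * (j + 1)))))}

/-- `z` lies on the main part of the order-`k` branch with row index `l` and tip
x-coordinate `x`. -/
def OnMainPart (k : ℕ) (l x : ℤ) (z : V) : Prop :=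
  z.2 = rowY k l ∧ x ≤ z.1 ∧ z.1 ≤ x + bF k - 1

/-- First hitting time of the vertex `a` (with value `⊤` if `a` is never visited). -/
def hitTime (ω : ℕ → V) (a : V) : ℕ∞ :=
  sInf {n : ℕ∞ | ∃ t : ℕ, (t : ℕ∞) = n ∧ ω t = a}

/-- The constant `C'_β = ((3+β)/2) · Σ_{i≥0} (2i+1) β^{-i}`. -/
def Cprime (β : ℝ) : ℝ := ((3 + β) / 2) * ∑' i : ℕ, (2 * (i : ℝ) + 1) * (1 / β) ^ i

section HittingTime

lemma transProb_nonneg {β : ℝ} (hβ : 1 < β) (G : Set (Sym2 V)) (v w : V) :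
    0 ≤ transProb β G v w := by
  have hn : (0 : ℝ) ≤ ({u : V | s(v, u) ∈ G}.ncard : ℝ) := Nat.cast_nonneg _
  have hd : 0 ≤ β + ({u : V | s(v, u) ∈ G}.ncard : ℝ) - 1 := by linarith
  have h0 : 0 ≤ β := by linarith
  unfold transProb
  split_ifs <;> positivity

/-- The hitting time is dominated by the number of times `n` such that the vertex has not been
visited up to time `n`. -/
lemma hitTime_le_tsum (ω : ℕ → V) (a : V) :
    (hitTime ω a : ℝ≥0∞) ≤
      ∑' n : ℕ, {ω : ℕ → V | ∀ i ≤ n, ω i ≠ a}.indicator (fun _ => (1 : ℝ≥0∞)) ω := by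
  classical
  by_cases hex : ∃ t, ω t = a
  · have h1 : hitTime ω a ≤ (Nat.find hex : ℕ∞) := sInf_le ⟨_, rfl, Nat.find_spec hex⟩
    have h2 : (hitTime ω a : ℝ≥0∞) ≤ (Nat.find hex : ℝ≥0∞) := by
      have := ENat.toENNReal_le.mpr h1
      simpa using this
    refine h2.trans (le_trans (le_of_eq ?_)
      (ENNReal.sum_le_tsum (Finset.range (Nat.find hex))))
    rw [Finset.sum_congr rfl (g := fun _ => (1 : ℝ≥0∞))]
    · simp
    · intro n hn
      rw [Set.indicator_of_mem]
      intro i hi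
      exact Nat.find_min hex (lt_of_le_of_lt hi (Finset.mem_range.mp hn))
  · push Not at hex
    have : ∀ n : ℕ, {ω : ℕ → V | ∀ i ≤ n, ω i ≠ a}.indicator
        (fun _ => (1 : ℝ≥0∞)) ω = 1 := fun n => by
      rw [Set.indicator_of_mem]
      intro i _
      exact hex i
    simp only [this]
    rw [ENNReal.tsum_const_eq_top_of_ne_zero one_ne_zero]
    exact le_top

lemma measurableSet_avoid (a : V) (n : ℕ) :
    MeasurableSet {ω : ℕ → V | ∀ i ≤ n, ω i ≠ a} := by
  have : {ω : ℕ → V | ∀ i ≤ n, ω i ≠ a} =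
      ⋂ i : ℕ, ⋂ _ : i ≤ n, (fun ω : ℕ → V => ω i) ⁻¹' {a}ᶜ := by
    ext ω; simp
  rw [this]
  exact MeasurableSet.iInter fun i => MeasurableSet.iInter fun _ =>
    (measurable_pi_apply i) (MeasurableSet.singleton a).compl

variable {β : ℝ} {G : Set (Sym2 V)} {z₀ : V} {μ : Measure (ℕ → V)}

lemma measure_cylinder_succ (hβ : 1 < β) (hμ : IsWalkLaw β G z₀ μ) (n : ℕ) (f : ℕ → V)
    (hf : f 0 = z₀) (w : V) :
    μ {ω | ∀ i ≤ n + 1, ω i = Function.update f (n + 1) w i} =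
      μ {ω | ∀ i ≤ n, ω i = f i} * ENNReal.ofReal (transProb β G (f n) w) := by
  have hlt : ∀ i ≤ n, Function.update f (n + 1) w i = f i := fun i hi =>
    Function.update_of_ne (by omega) _ _
  rw [hμ.2 (n + 1) _ (by rw [hlt 0 (Nat.zero_le _), hf]), hμ.2 n f hf,
    Finset.prod_range_succ, hlt n le_rfl, Function.update_self,
    ENNReal.ofReal_mul (by
      exact Finset.prod_nonneg fun i _ => transProb_nonneg hβ _ _ _)]
  congr 2
  refine Finset.prod_congr rfl fun i hi => ?_
  have := Finset.mem_range.mp hi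
  rw [hlt i (by omega), hlt (i + 1) (by omega)]

lemma sum_measure_avoid_le (hβ : 1 < β) (hμ : IsWalkLaw β G z₀ μ) (a : V) (h : V → ℝ≥0∞)
    (hh : ∀ v, v ≠ a → 1 + ∑' w, ENNReal.ofReal (transProb β G v w) * h w ≤ h v)
    (m : ℕ) : ∀ (n : ℕ) (f : ℕ → V), f 0 = z₀ →
      ∑ j ∈ Finset.range m, μ ({ω | ∀ i ≤ n, ω i = f i} ∩ {ω | ∀ i ≤ n + j, ω i ≠ a}) ≤
        μ {ω | ∀ i ≤ n, ω i = f i} * h (f n) := by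
  induction m with
  | zero => simp
  | succ m ih =>
    intro n f hf
    by_cases hfa : f n = a
    · rw [Finset.sum_eq_zero]
      · exact zero_le
      · intro j _
        convert measure_empty (μ := μ)
        ext ω
        simp only [Set.mem_inter_iff, Set.mem_ofPred_eq, Set.mem_empty_iff_false, iff_false]
        rintro ⟨h1, h2⟩
        exact h2 n (by omega) ((h1 n le_rfl).trans hfa)
    have hstep : ∀ j, μ ({ω | ∀ i ≤ n, ω i = f i} ∩ {ω | ∀ i ≤ n + (j + 1), ω i ≠ a}) ≤
        ∑' w, μ ({ω | ∀ i ≤ n + 1, ω i = Function.update f (n + 1) w i} ∩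
          {ω | ∀ i ≤ n + 1 + j, ω i ≠ a}) := by
      intro j
      refine le_trans (measure_mono ?_) (measure_iUnion_le _)
      rintro ω ⟨h1, h2⟩
      refine Set.mem_iUnion.mpr ⟨ω (n + 1), ⟨fun i hi => ?_, fun i hi => h2 i (by omega)⟩⟩
      rcases Nat.lt_or_ge n i with hlt | hle
      · obtain rfl : i = n + 1 := by omega
        rw [Function.update_self]
      · rw [Function.update_of_ne (by omega), h1 i hle]
    rw [Finset.sum_range_succ']
    calc _ ≤ (∑ j ∈ Finset.range m, ∑' w,
            μ ({ω | ∀ i ≤ n + 1, ω i = Function.update f (n + 1) w i} ∩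
              {ω | ∀ i ≤ n + 1 + j, ω i ≠ a})) + μ {ω | ∀ i ≤ n, ω i = f i} :=
          add_le_add (Finset.sum_le_sum fun j _ => hstep j)
            (measure_mono Set.inter_subset_left)
      _ = (∑' w, ∑ j ∈ Finset.range m,
            μ ({ω | ∀ i ≤ n + 1, ω i = Function.update f (n + 1) w i} ∩
              {ω | ∀ i ≤ n + 1 + j, ω i ≠ a})) + μ {ω | ∀ i ≤ n, ω i = f i} := by
          rw [Summable.tsum_finsetSum fun _ _ => ENNReal.summable]
      _ ≤ (∑' w, μ {ω | ∀ i ≤ n, ω i = f i} *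
            (ENNReal.ofReal (transProb β G (f n) w) * h w)) +
            μ {ω | ∀ i ≤ n, ω i = f i} := by
          gcongr with w
          refine (ih (n + 1) (Function.update f (n + 1) w)
            (by rw [Function.update_of_ne (by omega), hf])).trans (le_of_eq ?_)
          rw [measure_cylinder_succ hβ hμ n f hf w, Function.update_self, mul_assoc]
      _ = μ {ω | ∀ i ≤ n, ω i = f i} *
            (1 + ∑' w, ENNReal.ofReal (transProb β G (f n) w) * h w) := by
          rw [ENNReal.tsum_mul_left, mul_add, mul_one, add_comm]
      _ ≤ _ := by gcongr; exact hh _ hfa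

/-- A nonnegative function that decreases by at least one in expectation at every step bounds
the expected hitting time. -/
theorem lintegral_hitTime_le (hβ : 1 < β) (hμ : IsWalkLaw β G z₀ μ) (a : V) (h : V → ℝ≥0∞)
    (hh : ∀ v, v ≠ a → 1 + ∑' w, ENNReal.ofReal (transProb β G v w) * h w ≤ h v) :
    ∫⁻ ω, (hitTime ω a : ℝ≥0∞) ∂μ ≤ h z₀ := by
  have hprob := hμ.1
  have hone : μ {ω | ∀ i ≤ 0, ω i = (fun _ : ℕ => z₀) i} = 1 := by
    rw [hμ.2 0 (fun _ => z₀) rfl]; simp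
  calc ∫⁻ ω, (hitTime ω a : ℝ≥0∞) ∂μ
      ≤ ∫⁻ ω, ∑' n : ℕ, {ω : ℕ → V | ∀ i ≤ n, ω i ≠ a}.indicator
          (fun _ => (1 : ℝ≥0∞)) ω ∂μ := lintegral_mono fun ω => hitTime_le_tsum ω a
    _ = ∑' n : ℕ, μ {ω : ℕ → V | ∀ i ≤ n, ω i ≠ a} := by
        rw [lintegral_tsum fun n =>
          (measurable_const.indicator (measurableSet_avoid a n)).aemeasurable]
        congr 1
        ext n
        rw [lintegral_indicator_const (measurableSet_avoid a n), one_mul]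
    _ ≤ h z₀ := by
        refine ENNReal.tsum_le_of_sum_range_le fun m => ?_
        have hm := sum_measure_avoid_le hβ hμ a h hh m 0 (fun _ => z₀) rfl
        rw [hone, one_mul] at hm
        refine le_trans (Finset.sum_le_sum fun j _ => ?_) hm
        have hae : ∀ᵐ ω ∂μ, ω ∈ {ω : ℕ → V | ∀ i ≤ 0, ω i = (fun _ : ℕ => z₀) i} := by
          have hms : MeasurableSet {ω : ℕ → V | ∀ i ≤ 0, ω i = (fun _ : ℕ => z₀) i} := by
            have : {ω : ℕ → V | ∀ i ≤ 0, ω i = (fun _ : ℕ => z₀) i} =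
                (fun ω : ℕ → V => ω 0) ⁻¹' {z₀} := by
              ext ω; simp
            rw [this]
            exact (measurable_pi_apply 0) (MeasurableSet.singleton z₀)
          exact (mem_ae_iff_prob_eq_one hms).mpr hone
        refine measure_mono_ae ?_
        filter_upwards [hae] with ω hω h2
        exact ⟨hω, by rw [Nat.zero_add]; exact h2⟩

end HittingTime

section OneStep

variable {β : ℝ} {G : Set (Sym2 V)} {h : V → ℝ≥0∞} {v : V}

lemma transProb_eq_zero_of_notMem {N : Finset V} (hN : {u : V | s(v, u) ∈ G} = ↑N)
    (hne : N.Nonempty) {w : V} (hw : w ∉ N) : transProb β G v w = 0 := by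
  have h1 : {u : V | s(v, u) ∈ G} ≠ ∅ := by
    rw [hN]; exact (Finset.coe_nonempty.mpr hne).ne_empty
  have h2 : s(v, w) ∉ G := fun hc => hw (by
    have : w ∈ {u : V | s(v, u) ∈ G} := hc
    rw [hN] at this; exact this)
  simp [transProb, h1, h2]

lemma transProb_of_right_mem {N : Finset V} (hN : {u : V | s(v, u) ∈ G} = ↑N)
    (hr : (v.1 + 1, v.2) ∈ N) {w : V} (hw : w ∈ N) :
    transProb β G v w =
      (if w = (v.1 + 1, v.2) then β else 1) / (β + (N.card : ℝ) - 1) := by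
  have h1 : {u : V | s(v, u) ∈ G} ≠ ∅ := by
    rw [hN]; exact (Finset.coe_nonempty.mpr ⟨_, hr⟩).ne_empty
  have h2 : ∀ u ∈ N, s(v, u) ∈ G := fun u hu => by
    have : u ∈ (N : Set V) := hu
    rw [← hN] at this; exact this
  rw [transProb, if_neg h1, if_pos (h2 w hw), if_pos (h2 _ hr), hN, Set.ncard_coe_finset]
  split_ifs <;> rfl

lemma transProb_of_right_notMem {N : Finset V} (hN : {u : V | s(v, u) ∈ G} = ↑N)
    (hr : (v.1 + 1, v.2) ∉ N) {w : V} (hw : w ∈ N) :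
    transProb β G v w = 1 / (N.card : ℝ) := by
  have h1 : {u : V | s(v, u) ∈ G} ≠ ∅ := by
    rw [hN]; exact (Finset.coe_nonempty.mpr ⟨_, hw⟩).ne_empty
  have h2 : ∀ u, s(v, u) ∈ G ↔ u ∈ N := fun u => by
    rw [← Finset.mem_coe, ← hN]; rfl
  rw [transProb, if_neg h1, if_pos ((h2 w).mpr hw), if_neg (mt (h2 _).mp hr), hN,
    Set.ncard_coe_finset]

lemma one_add_tsum_le (hβ : 1 < β) {N : Finset V} (hN : {u : V | s(v, u) ∈ G} = ↑N)
    (hne : N.Nonempty) (ρ : V → ℝ) {r : ℝ}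
    (hρ : ∀ w ∈ N, 0 ≤ ρ w ∧ h w ≤ ENNReal.ofReal (ρ w))
    (hr : 1 + ∑ w ∈ N, transProb β G v w * ρ w ≤ r) :
    1 + ∑' w, ENNReal.ofReal (transProb β G v w) * h w ≤ ENNReal.ofReal r := by
  have hp : ∀ w ∈ N, 0 ≤ transProb β G v w * ρ w := fun w hw =>
    mul_nonneg (transProb_nonneg hβ G v w) (hρ w hw).1
  rw [tsum_eq_sum (s := N) fun w hw => by rw [transProb_eq_zero_of_notMem hN hne hw]; simp]
  refine le_trans ?_ (ENNReal.ofReal_le_ofReal hr)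
  rw [ENNReal.ofReal_add zero_le_one (Finset.sum_nonneg hp), ENNReal.ofReal_one,
    ENNReal.ofReal_sum_of_nonneg hp]
  gcongr with w hw
  rw [ENNReal.ofReal_mul (transProb_nonneg hβ G v w)]
  gcongr
  exact (hρ w hw).2

lemma one_add_tsum_le_right (hβ : 1 < β) (hN : {u : V | s(v, u) ∈ G} = {(v.1 + 1, v.2)})
    {r₁ r : ℝ} (h₁ : 0 ≤ r₁ ∧ h (v.1 + 1, v.2) ≤ ENNReal.ofReal r₁) (hr : 1 + r₁ ≤ r) :
    1 + ∑' w, ENNReal.ofReal (transProb β G v w) * h w ≤ ENNReal.ofReal r := by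
  have hN' : {u : V | s(v, u) ∈ G} = ↑({(v.1 + 1, v.2)} : Finset V) := by rw [hN]; simp
  refine one_add_tsum_le hβ hN' (by simp) (fun _ => r₁) (by simpa using h₁) ?_
  rw [Finset.sum_singleton, transProb_of_right_mem hN' (by simp) (by simp)]
  have : β ≠ 0 := by linarith
  simpa [this] using hr

lemma one_add_tsum_le_right_left (hβ : 1 < β)
    (hN : {u : V | s(v, u) ∈ G} = {(v.1 + 1, v.2), (v.1 - 1, v.2)})
    {r₁ r₂ r : ℝ} (h₁ : 0 ≤ r₁ ∧ h (v.1 + 1, v.2) ≤ ENNReal.ofReal r₁)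
    (h₂ : 0 ≤ r₂ ∧ h (v.1 - 1, v.2) ≤ ENNReal.ofReal r₂)
    (hr : β + 1 + (β * r₁ + r₂) ≤ (β + 1) * r) :
    1 + ∑' w, ENNReal.ofReal (transProb β G v w) * h w ≤ ENNReal.ofReal r := by
  have hN' : {u : V | s(v, u) ∈ G} = ↑({(v.1 + 1, v.2), (v.1 - 1, v.2)} : Finset V) := by
    rw [hN]; simp
  have n12 : ((v.1 - 1, v.2) : V) ≠ (v.1 + 1, v.2) := by
    simp [Prod.ext_iff]; omega
  refine one_add_tsum_le hβ hN' (by simp)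
    (fun w => if w = (v.1 + 1, v.2) then r₁ else r₂) ?_ ?_
  · intro w hw
    rcases Finset.mem_insert.mp hw with rfl | hw
    · simpa using h₁
    · rw [Finset.mem_singleton.mp hw, if_neg n12]; exact h₂
  · rw [Finset.sum_pair n12.symm, transProb_of_right_mem hN' (by simp) (by simp),
      transProb_of_right_mem hN' (by simp) (by simp), Finset.card_pair n12.symm,
      if_pos rfl, if_neg n12, if_pos rfl, if_neg n12]
    have : 0 < β + 1 := by linarith
    rw [show β + ((2 : ℕ) : ℝ) - 1 = β + 1 by push_cast; ring]
    field_simp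
    linarith

lemma one_add_tsum_le_cross (hβ : 1 < β)
    (hN : {u : V | s(v, u) ∈ G} =
      {(v.1 + 1, v.2), (v.1 - 1, v.2), (v.1, v.2 + 1), (v.1, v.2 - 1)})
    {r₁ r₂ r₃ r : ℝ} (h₁ : 0 ≤ r₁ ∧ h (v.1 + 1, v.2) ≤ ENNReal.ofReal r₁)
    (h₂ : 0 ≤ r₂ ∧ h (v.1 - 1, v.2) ≤ ENNReal.ofReal r₂)
    (h₃ : 0 ≤ r₃ ∧ h (v.1, v.2 + 1) ≤ ENNReal.ofReal r₃)
    (h₄ : h (v.1, v.2 - 1) ≤ ENNReal.ofReal r₃)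
    (hr : β + 3 + (β * r₁ + r₂ + 2 * r₃) ≤ (β + 3) * r) :
    1 + ∑' w, ENNReal.ofReal (transProb β G v w) * h w ≤ ENNReal.ofReal r := by
  have hN' : {u : V | s(v, u) ∈ G} = ↑({(v.1 + 1, v.2), (v.1 - 1, v.2), (v.1, v.2 + 1),
      (v.1, v.2 - 1)} : Finset V) := by
    rw [hN]; simp
  have n12 : ((v.1 - 1, v.2) : V) ≠ (v.1 + 1, v.2) := by
    simp [Prod.ext_iff]; omega
  have n13 : ((v.1, v.2 + 1) : V) ≠ (v.1 + 1, v.2) := by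
    simp [Prod.ext_iff]
  have n14 : ((v.1, v.2 - 1) : V) ≠ (v.1 + 1, v.2) := by
    simp [Prod.ext_iff]
  have n23 : ((v.1, v.2 + 1) : V) ≠ (v.1 - 1, v.2) := by
    simp [Prod.ext_iff]
  have n24 : ((v.1, v.2 - 1) : V) ≠ (v.1 - 1, v.2) := by
    simp [Prod.ext_iff]
  have n34 : ((v.1, v.2 - 1) : V) ≠ (v.1, v.2 + 1) := by
    simp [Prod.ext_iff]; omega
  have hcard : ({(v.1 + 1, v.2), (v.1 - 1, v.2), (v.1, v.2 + 1),
      (v.1, v.2 - 1)} : Finset V).card = 4 := by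
    rw [Finset.card_insert_of_notMem (by simp [n12.symm, n13.symm, n14.symm]),
      Finset.card_insert_of_notMem (by simp [n23.symm, n24.symm]), Finset.card_pair n34.symm]
  refine one_add_tsum_le hβ hN' (by simp)
    (fun w => if w = (v.1 + 1, v.2) then r₁ else if w = (v.1 - 1, v.2) then r₂ else r₃) ?_ ?_
  · intro w hw
    simp only [Finset.mem_insert, Finset.mem_singleton] at hw
    rcases hw with rfl | rfl | rfl | rfl
    · simpa using h₁
    · rw [if_neg n12, if_pos rfl]; exact h₂
    · rw [if_neg n13, if_neg n23]; exact h₃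
    · rw [if_neg n14, if_neg n24]; exact ⟨h₃.1, h₄⟩
  · rw [Finset.sum_insert (by simp [n12.symm, n13.symm, n14.symm]),
      Finset.sum_insert (by simp [n23.symm, n24.symm]), Finset.sum_pair n34.symm,
      transProb_of_right_mem hN' (by simp) (by simp),
      transProb_of_right_mem hN' (by simp) (by simp),
      transProb_of_right_mem hN' (by simp) (by simp),
      transProb_of_right_mem hN' (by simp) (by simp), hcard]
    simp only [if_neg n12, if_neg n13, if_neg n14, if_neg n23, if_neg n24, if_true]
    have : 0 < β + 3 := by linarith
    rw [show β + ((4 : ℕ) : ℝ) - 1 = β + 3 by push_cast; ring]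
    field_simp
    linarith

lemma one_add_tsum_le_pair (hβ : 1 < β) {u w : V} (huw : u ≠ w)
    (hN : {u : V | s(v, u) ∈ G} = {u, w}) (hu : (v.1 + 1, v.2) ≠ u) (hw : (v.1 + 1, v.2) ≠ w)
    {r₁ r₂ r : ℝ} (h₁ : 0 ≤ r₁ ∧ h u ≤ ENNReal.ofReal r₁)
    (h₂ : 0 ≤ r₂ ∧ h w ≤ ENNReal.ofReal r₂) (hr : 2 + (r₁ + r₂) ≤ 2 * r) :
    1 + ∑' w, ENNReal.ofReal (transProb β G v w) * h w ≤ ENNReal.ofReal r := by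
  have hN' : {u : V | s(v, u) ∈ G} = ↑({u, w} : Finset V) := by
    rw [hN]; simp
  have hnot : (v.1 + 1, v.2) ∉ ({u, w} : Finset V) := by simp [hu, hw]
  refine one_add_tsum_le hβ hN' (by simp) (fun y => if y = u then r₁ else r₂) ?_ ?_
  · intro y hy
    rcases Finset.mem_insert.mp hy with rfl | hy
    · simpa using h₁
    · rw [Finset.mem_singleton.mp hy, if_neg huw.symm]; exact h₂
  · rw [Finset.sum_pair huw, transProb_of_right_notMem hN' hnot (by simp),
      transProb_of_right_notMem hN' hnot (by simp), Finset.card_pair huw,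
      if_pos rfl, if_neg huw.symm]
    push_cast
    linarith

end OneStep

section Geometry

lemma bF_pos (k : ℕ) : 0 < bF k := by unfold bF; positivity

lemma four_le_bF (k : ℕ) : 4 ≤ bF k := by
  have : 0 < 3 ^ (k * (k - 1) / 2) := by positivity
  unfold bF; omega

lemma bF_succ (k : ℕ) : bF (k + 1) = 3 ^ k * bF k := by
  unfold bF
  have : (k + 1) * (k + 1 - 1) / 2 = k + k * (k - 1) / 2 := by
    rcases k with _ | k
    · rfl
    · rw [show (k + 1 + 1) * (k + 1 + 1 - 1) = (k + 1) * 2 + (k + 1) * (k + 1 - 1) by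
        simp only [Nat.add_sub_cancel]; ring]
      omega
  rw [this, pow_add]; ring

lemma qF_add_one (k : ℕ) : qF k + 1 = 3 ^ k := by
  have : 0 < 3 ^ k := by positivity
  unfold qF; omega

lemma bF_succ_eq (k : ℕ) : bF (k + 1) = qF k * bF k + bF k := by
  rw [bF_succ, ← qF_add_one]; ring

lemma bF_dvd_bF {i k : ℕ} (h : i ≤ k) : bF i ∣ bF k := by
  induction k, h using Nat.le_induction with
  | base => exact dvd_rfl
  | succ k _ ih => rw [bF_succ]; exact ih.mul_left _

lemma IsTip.dvd {k : ℕ} {x : ℤ} (h : IsTip k x) : (bF k : ℤ) ∣ x := by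
  induction h with
  | zero k => exact dvd_zero _
  | step k x j _ _ _ ih =>
    refine dvd_add (dvd_trans ?_ ih) (dvd_mul_left _ _)
    exact_mod_cast bF_dvd_bF (Nat.le_succ k)

/-- A branch of order `i < k` lies over the interior of a branch of order `k`. -/
lemma IsTip.exists_ancestor {i k : ℕ} (hi : 1 ≤ i) (hik : i < k) {x : ℤ} (h : IsTip i x) :
    ∃ x', IsTip k x' ∧ x' ≤ x ∧ x + bF i < x' + bF k := by
  induction k, hik using Nat.le_induction with
  | base =>
    have hb : (bF (i + 1) : ℤ) = qF i * bF i + bF i := by exact_mod_cast bF_succ_eq i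
    have hpos : (0 : ℤ) < bF i := by exact_mod_cast bF_pos i
    cases h with
    | zero =>
      have hq : 1 ≤ qF i := by
        have := qF_add_one i
        have : 3 ^ 1 ≤ 3 ^ i := Nat.pow_le_pow_right (by norm_num) hi
        omega
      have hq' : (1 : ℤ) ≤ qF i := by exact_mod_cast hq
      exact ⟨0, IsTip.zero _, le_rfl, by rw [Nat.succ_eq_add_one] at *; nlinarith⟩
    | step _ x' j hx' h1 h2 =>
      have h1' : (1 : ℤ) ≤ j := by exact_mod_cast h1
      have h2' : (j : ℤ) ≤ qF i := by exact_mod_cast h2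
      exact ⟨x', hx', by nlinarith, by rw [Nat.succ_eq_add_one] at *; nlinarith⟩
  | succ k hk ih =>
    obtain ⟨x', hx', h1, h2⟩ := ih
    have hb : (bF (k + 1) : ℤ) = qF k * bF k + bF k := by exact_mod_cast bF_succ_eq k
    have hpos : (0 : ℤ) < bF k := by exact_mod_cast bF_pos k
    cases hx' with
    | zero =>
      have hq' : (0 : ℤ) ≤ qF k := by positivity
      exact ⟨0, IsTip.zero _, h1, by nlinarith⟩
    | step _ x'' j hx'' h3 h4 =>
      have h3' : (1 : ℤ) ≤ j := by exact_mod_cast h3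
      have h4' : (j : ℤ) ≤ qF k := by exact_mod_cast h4
      exact ⟨x'', hx'', by nlinarith, by nlinarith⟩

lemma IsTip.not_dvd_of_lt {k : ℕ} {x p : ℤ} (h : IsTip k x) (h1 : x ≤ p)
    (h2 : p + 1 < x + bF k) : ¬ (bF k : ℤ) ∣ p + 1 := by
  intro hd
  have := Int.eq_zero_of_abs_lt_dvd (hd.sub h.dvd) (by rw [abs_lt]; constructor <;> linarith)
  linarith

lemma IsTip.not_dvd_of_order_lt {i k : ℕ} (hi : 1 ≤ i) (hik : i < k) {x p : ℤ}
    (h : IsTip i x) (h1 : x ≤ p) (h2 : p + 1 ≤ x + bF i) : ¬ (bF k : ℤ) ∣ p + 1 := by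
  obtain ⟨x', hx', h3, h4⟩ := h.exists_ancestor hi hik
  exact hx'.not_dvd_of_lt (h3.trans h1) (by linarith)

lemma rowY_eq_of_le {i k : ℕ} (hi : 1 ≤ i) (hik : i ≤ k) (l : ℤ) :
    rowY k l = 3 * 2 ^ (i - 1) * (2 ^ (k - i) * l) := by
  rw [rowY, show k - 1 = (i - 1) + (k - i) by omega, pow_add]; ring

lemma rowY_inj {i k : ℕ} (hi : 1 ≤ i) (hk : 1 ≤ k) {l m : ℤ} (hl : Odd l) (hm : Odd m)
    (h : rowY k l = rowY i m) : k = i ∧ l = m := by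
  wlog hik : i ≤ k generalizing i k l m
  · obtain ⟨h1, h2⟩ := this hk hi hm hl h.symm (by omega)
    exact ⟨h1.symm, h2.symm⟩
  rw [rowY_eq_of_le hi hik, rowY] at h
  have h' := mul_left_cancel₀ (by positivity) h
  rcases Nat.eq_or_lt_of_le hik with rfl | hlt
  · simpa using h'
  · exfalso
    have : Even m := by
      rw [← h', show k - i = (k - i - 1) + 1 by omega, pow_succ]
      exact ⟨2 ^ (k - i - 1) * l, by ring⟩
    exact (Int.not_even_iff_odd.mpr hm) this

lemma dirF_attached {m ε : ℤ} (hm : Odd m) (hε : ε = 1 ∨ ε = -1) : dirF (2 * m + ε) = -ε := by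
  obtain ⟨n, rfl⟩ := hm
  rcases hε with rfl | rfl
  · have : (2 * (2 * n + 1) + 1 + 1) / 2 = 2 * (n + 1) := by omega
    rw [dirF, this, if_neg (by simp)]
  · have : (2 * (2 * n + 1) + -1 + 1) / 2 = 2 * n + 1 := by omega
    rw [dirF, this, if_pos ⟨n, rfl⟩]; rfl

lemma exists_odd_row {l : ℤ} (hl : Odd l) :
    ∃ m ε : ℤ, Odd m ∧ (ε = 1 ∨ ε = -1) ∧ l = 2 * m + ε := by
  obtain ⟨n, rfl⟩ := hl
  rcases Int.even_or_odd n with h | h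
  · exact ⟨n + 1, -1, h.add_one, Or.inr rfl, by ring⟩
  · exact ⟨n, 1, h, Or.inl rfl, by ring⟩

lemma horizontal_mem_iff (p y : ℤ) :
    s(((p, y) : V), (p + 1, y)) ∈ xiEdges ↔
      ∃ (k : ℕ) (l x : ℤ), 1 ≤ k ∧ Odd l ∧ IsTip k x ∧ y = rowY k l ∧ x ≤ p ∧
        p + 2 ≤ x + bF k := by
  constructor
  · rintro ⟨k, l, x, hk, hl, hx, ⟨i, hi, he⟩ | ⟨j, hj, he⟩⟩
    · refine ⟨k, l, x, hk, hl, hx, ?_⟩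
      simp only [Sym2.eq_iff, Prod.mk.injEq] at he
      omega
    · simp only [Sym2.eq_iff, Prod.mk.injEq] at he
      omega
  · rintro ⟨k, l, x, hk, hl, hx, rfl, h1, h2⟩
    refine ⟨k, l, x, hk, hl, hx, Or.inl ⟨(p - x).toNat, by omega, ?_⟩⟩
    rw [Int.toNat_of_nonneg (by omega)]
    congr 2 <;> simp

lemma vertical_mem_iff (p y : ℤ) :
    s(((p, y) : V), (p, y + 1)) ∈ xiEdges ↔
      ∃ (k : ℕ) (m x : ℤ), 1 ≤ k ∧ Odd m ∧ IsTip k x ∧ p + 1 = x + bF k ∧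
        rowY (k + 1) m - 3 * 2 ^ (k - 1) ≤ y ∧ y + 1 ≤ rowY (k + 1) m + 3 * 2 ^ (k - 1) := by
  constructor
  · rintro ⟨k, l, x, hk, hl, hx, ⟨i, hi, he⟩ | ⟨j, hj, he⟩⟩
    · simp only [Sym2.eq_iff, Prod.mk.injEq] at he
      omega
    · obtain ⟨m, ε, hm, hε, rfl⟩ := exists_odd_row hl
      refine ⟨k, m, x, hk, hm, hx, ?_⟩
      rw [dirF_attached hm hε] at he
      have hr : rowY k (2 * m + ε) = rowY (k + 1) m + ε * (3 * 2 ^ (k - 1)) := by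
        rw [rowY_eq_of_le (i := k) hk (Nat.le_succ k), rowY,
          show k.succ - k = 1 by omega]; ring
      rw [hr] at he
      have hj' : (j : ℤ) < 3 * 2 ^ (k - 1) := by exact_mod_cast hj
      simp only [Sym2.eq_iff, Prod.mk.injEq] at he
      rcases hε with rfl | rfl <;> omega
  · rintro ⟨k, m, x, hk, hm, hx, hp, h1, h2⟩
    have hr : ∀ ε : ℤ, rowY k (2 * m + ε) = rowY (k + 1) m + ε * (3 * 2 ^ (k - 1)) := by
      intro ε
      rw [rowY_eq_of_le (i := k) hk (Nat.le_succ k), rowY, show k.succ - k = 1 by omega]; ring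
    rcases lt_or_ge y (rowY (k + 1) m) with h | h
    · refine ⟨k, 2 * m + -1, x, hk, ⟨m - 1, by ring⟩, hx, Or.inr
        ⟨(y - (rowY (k + 1) m - 3 * 2 ^ (k - 1))).toNat, ?_, ?_⟩⟩
      · zify
        rw [Int.toNat_of_nonneg (by omega)]; omega
      · rw [dirF_attached hm (Or.inr rfl), hr, Int.toNat_of_nonneg (by omega)]
        simp only [Sym2.eq_iff, Prod.mk.injEq]
        omega
    · refine ⟨k, 2 * m + 1, x, hk, ⟨m, by ring⟩, hx, Or.inr
        ⟨(rowY (k + 1) m + 3 * 2 ^ (k - 1) - y - 1).toNat, ?_, ?_⟩⟩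
      · zify
        rw [Int.toNat_of_nonneg (by omega)]; omega
      · rw [dirF_attached hm (Or.inl rfl), hr, Int.toNat_of_nonneg (by omega)]
        simp only [Sym2.eq_iff, Prod.mk.injEq]
        omega

/-- The neighbours of a vertex are among its four lattice neighbours. -/
lemma neighbor_cases {p y : ℤ} {u : V} (h : s(((p, y) : V), u) ∈ xiEdges) :
    u = (p + 1, y) ∨ u = (p - 1, y) ∨ u = (p, y + 1) ∨ u = (p, y - 1) := by
  obtain ⟨a, b⟩ := u
  obtain ⟨k, l, x, hk, hl, hx, ⟨i, hi, he⟩ | ⟨j, hj, he⟩⟩ := h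
  · simp only [Sym2.eq_iff, Prod.mk.injEq] at he ⊢
    omega
  · have hd : dirF l = 1 ∨ dirF l = -1 := by unfold dirF; split_ifs <;> simp
    simp only [Sym2.eq_iff, Prod.mk.injEq] at he ⊢
    rcases hd with hd | hd <;> rw [hd] at he <;> omega

lemma left_mem_iff (p y : ℤ) :
    s(((p, y) : V), (p - 1, y)) ∈ xiEdges ↔ s(((p - 1, y) : V), (p - 1 + 1, y)) ∈ xiEdges := by
  rw [Sym2.eq_swap, sub_add_cancel]

lemma down_mem_iff (p y : ℤ) :
    s(((p, y) : V), (p, y - 1)) ∈ xiEdges ↔ s(((p, y - 1) : V), (p, y - 1 + 1)) ∈ xiEdges := by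
  rw [Sym2.eq_swap, sub_add_cancel]

/-- `(p, y)` lies on an abutment of order `i` over the row `m` of order `i + 1`. -/
def OnAbutment (i : ℕ) (m x p y : ℤ) : Prop :=
  1 ≤ i ∧ Odd m ∧ IsTip i x ∧ p + 1 = x + bF i ∧ |y - rowY (i + 1) m| ≤ 3 * 2 ^ (i - 1)

lemma exists_abutment_of_up {p y : ℤ} (h : s(((p, y) : V), (p, y + 1)) ∈ xiEdges) :
    ∃ i m x, OnAbutment i m x p y ∧ |y + 1 - rowY (i + 1) m| ≤ 3 * 2 ^ (i - 1) := by
  obtain ⟨i, m, x, hi, hm, hx, hp, h1, h2⟩ := (vertical_mem_iff p y).mp h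
  refine ⟨i, m, x, ⟨hi, hm, hx, hp, ?_⟩, ?_⟩ <;> rw [abs_le] <;> constructor <;> linarith

lemma exists_abutment_of_down {p y : ℤ} (h : s(((p, y) : V), (p, y - 1)) ∈ xiEdges) :
    ∃ i m x, OnAbutment i m x p y ∧ |y - 1 - rowY (i + 1) m| ≤ 3 * 2 ^ (i - 1) := by
  obtain ⟨i, m, x, hi, hm, hx, hp, h1, h2⟩ :=
    (vertical_mem_iff p (y - 1)).mp ((down_mem_iff p y).mp h)
  refine ⟨i, m, x, ⟨hi, hm, hx, hp, ?_⟩, ?_⟩ <;> rw [abs_le] <;> constructor <;> linarith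

/-- A vertex of an order-`k` row that lies on an abutment of smaller order is its root. -/
lemma OnAbutment.eq_of_lt {i k : ℕ} {m x p l : ℤ} (h : OnAbutment i m x p (rowY k l))
    (hl : Odd l) (hik : i < k) : k = i + 1 ∧ m = l := by
  obtain ⟨hi, hm, hx, hp, hy⟩ := h
  have h2 : rowY k l - rowY (i + 1) m = 3 * 2 ^ (i - 1) * (2 * (2 ^ (k - (i + 1)) * l - m)) := by
    rw [rowY_eq_of_le (i := i + 1) (by omega) hik, rowY,
      show i + 1 - 1 = (i - 1) + 1 by omega, pow_succ]; ring
  rw [h2, abs_mul, abs_of_pos (by positivity : (0 : ℤ) < 3 * 2 ^ (i - 1))] at hy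
  have h3 : |2 * (2 ^ (k - (i + 1)) * l - m)| ≤ 1 := by
    by_contra hc
    have hpos : (0 : ℤ) < 3 * 2 ^ (i - 1) := by positivity
    nlinarith
  have h4 : 2 ^ (k - (i + 1)) * l - m = 0 := by rw [abs_le] at h3; omega
  have h5 : rowY k l = rowY (i + 1) m := by
    rw [h4] at h2; linarith
  obtain ⟨h6, h7⟩ := rowY_inj (by omega) (by omega) hl hm h5
  exact ⟨h6, h7.symm⟩

lemma not_dvd_of_horizontal {k : ℕ} {l p : ℤ} (hk : 1 ≤ k) (hl : Odd l)
    (h : s(((p, rowY k l) : V), (p + 1, rowY k l)) ∈ xiEdges) : ¬ (bF k : ℤ) ∣ p + 1 := by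
  obtain ⟨i, m, x, hi, hm, hx, hy, h1, h2⟩ := (horizontal_mem_iff _ _).mp h
  obtain ⟨rfl, rfl⟩ := rowY_inj hi hk hl hm hy
  exact hx.not_dvd_of_lt h1 (by linarith)

lemma dvd_of_abutment {k i : ℕ} {l x m x' p : ℤ} (hk : 1 ≤ k) (hl : Odd l) (hx : IsTip k x)
    (h1 : x ≤ p) (h2 : p + 2 ≤ x + bF k) (h : OnAbutment i m x' p (rowY k l)) :
    2 ≤ k ∧ (bF (k - 1) : ℤ) ∣ p + 1 := by
  have hd : (bF i : ℤ) ∣ p + 1 := by rw [h.2.2.2.1]; exact h.2.2.1.dvd.add dvd_rfl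
  rcases lt_trichotomy i k with hik | rfl | hik
  · obtain ⟨rfl, rfl⟩ := h.eq_of_lt hl hik
    exact ⟨by have := h.1; omega, hd⟩
  · exact absurd hd (hx.not_dvd_of_lt h1 (by linarith))
  · exact absurd hd (hx.not_dvd_of_order_lt hk hik h1 (by linarith))

lemma neighbors_tip {k : ℕ} {l x : ℤ} (hk : 1 ≤ k) (hl : Odd l) (hx : IsTip k x) :
    {u : V | s(((x, rowY k l) : V), u) ∈ xiEdges} = {(x + 1, rowY k l)} := by
  have hb : (4 : ℤ) ≤ bF k := by exact_mod_cast four_le_bF k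
  have hvert : ∀ i m x', ¬ OnAbutment i m x' x (rowY k l) := by
    intro i m x' h
    obtain ⟨-, h2⟩ := dvd_of_abutment hk hl hx le_rfl (by linarith) h
    have h3 : (bF (k - 1) : ℤ) ∣ 1 := by
      have h4 : (bF (k - 1) : ℤ) ∣ x :=
        dvd_trans (by exact_mod_cast bF_dvd_bF (Nat.sub_le k 1)) hx.dvd
      simpa using h2.sub h4
    have h5 : (4 : ℤ) ≤ bF (k - 1) := by exact_mod_cast four_le_bF _
    have := Int.le_of_dvd one_pos h3
    linarith
  ext u
  constructor
  · intro hu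
    have hu : s(((x, rowY k l) : V), u) ∈ xiEdges := hu
    rcases neighbor_cases hu with rfl | rfl | rfl | rfl
    · rfl
    · refine absurd ?_ (not_dvd_of_horizontal hk hl ((left_mem_iff _ _).mp hu))
      rw [sub_add_cancel]; exact hx.dvd
    · obtain ⟨i, m, x', h, -⟩ := exists_abutment_of_up hu
      exact absurd h (hvert _ _ _)
    · obtain ⟨i, m, x', h, -⟩ := exists_abutment_of_down hu
      exact absurd h (hvert _ _ _)
  · rintro rfl
    exact (horizontal_mem_iff _ _).mpr ⟨k, l, x, hk, hl, hx, rfl, le_rfl, by linarith⟩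

lemma right_mem {k : ℕ} {l x p : ℤ} (hk : 1 ≤ k) (hl : Odd l) (hx : IsTip k x) (h1 : x ≤ p)
    (h2 : p + 2 ≤ x + bF k) : s(((p, rowY k l) : V), (p + 1, rowY k l)) ∈ xiEdges :=
  (horizontal_mem_iff _ _).mpr ⟨k, l, x, hk, hl, hx, rfl, h1, h2⟩

lemma left_mem {k : ℕ} {l x p : ℤ} (hk : 1 ≤ k) (hl : Odd l) (hx : IsTip k x) (h1 : x < p)
    (h2 : p + 1 ≤ x + bF k) : s(((p, rowY k l) : V), (p - 1, rowY k l)) ∈ xiEdges :=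
  (left_mem_iff _ _).mpr (right_mem hk hl hx (by linarith) (by linarith))

lemma neighbors_plain {k : ℕ} {l x p : ℤ} (hk : 1 ≤ k) (hl : Odd l) (hx : IsTip k x)
    (h1 : x < p) (h2 : p + 2 ≤ x + bF k) (hp : ¬ (bF (k - 1) : ℤ) ∣ p + 1) :
    {u : V | s(((p, rowY k l) : V), u) ∈ xiEdges} =
      {(p + 1, rowY k l), (p - 1, rowY k l)} := by
  ext u
  constructor
  · intro hu
    have hu : s(((p, rowY k l) : V), u) ∈ xiEdges := hu
    rcases neighbor_cases hu with rfl | rfl | rfl | rfl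
    · exact Or.inl rfl
    · exact Or.inr rfl
    · obtain ⟨i, m, x', h, -⟩ := exists_abutment_of_up hu
      exact absurd (dvd_of_abutment hk hl hx h1.le h2 h).2 hp
    · obtain ⟨i, m, x', h, -⟩ := exists_abutment_of_down hu
      exact absurd (dvd_of_abutment hk hl hx h1.le h2 h).2 hp
  · rintro (rfl | rfl)
    · exact right_mem hk hl hx h1.le h2
    · exact left_mem hk hl hx h1 (by linarith)

lemma neighbors_root {k : ℕ} {l x p : ℤ} (hk : 1 ≤ k) (hl : Odd l) (hx : IsTip (k + 1) x)
    (h1 : x < p) (h2 : p + 2 ≤ x + bF (k + 1)) {x' : ℤ} (hx' : IsTip k x')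
    (hp : p + 1 = x' + bF k) :
    {u : V | s(((p, rowY (k + 1) l) : V), u) ∈ xiEdges} =
      {(p + 1, rowY (k + 1) l), (p - 1, rowY (k + 1) l), (p, rowY (k + 1) l + 1),
        (p, rowY (k + 1) l - 1)} := by
  have hpos : (0 : ℤ) < 2 ^ (k - 1) := by positivity
  ext u
  constructor
  · exact fun hu => neighbor_cases hu
  · rintro (rfl | rfl | rfl | rfl)
    · exact right_mem (by omega) hl hx h1.le h2
    · exact left_mem (by omega) hl hx h1 (by linarith)
    · exact (vertical_mem_iff _ _).mpr ⟨k, l, x', hk, hl, hx', hp, by linarith, by linarith⟩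
    · exact (down_mem_iff _ _).mpr ((vertical_mem_iff _ _).mpr
        ⟨k, l, x', hk, hl, hx', hp, by linarith, by linarith⟩)

lemma neighbors_corner {k : ℕ} {m ε x p : ℤ} (hk : 1 ≤ k) (hm : Odd m)
    (hε : ε = 1 ∨ ε = -1) (hx : IsTip k x) (hp : p + 1 = x + bF k) :
    {u : V | s(((p, rowY k (2 * m + ε)) : V), u) ∈ xiEdges} =
      {(p - 1, rowY k (2 * m + ε)), (p, rowY k (2 * m + ε) - ε)} := by
  have hb : (4 : ℤ) ≤ bF k := by exact_mod_cast four_le_bF k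
  have hpos : (0 : ℤ) < 2 ^ (k - 1) := by positivity
  have hl : Odd (2 * m + ε) := by
    rcases hε with rfl | rfl
    · exact ⟨m, rfl⟩
    · exact ⟨m - 1, by ring⟩
  have hd : (bF k : ℤ) ∣ p + 1 := by rw [hp]; exact hx.dvd.add dvd_rfl
  have hr : ∀ m' : ℤ, rowY k (2 * m + ε) - rowY (k + 1) m' =
      3 * 2 ^ (k - 1) * (2 * (m - m') + ε) := by
    intro m'
    rw [rowY_eq_of_le (i := k) (k := k + 1) hk (Nat.le_succ k), rowY,
      show k + 1 - k = 1 by omega]; ring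
  have hvert : ∀ i m' x', OnAbutment i m' x' p (rowY k (2 * m + ε)) →
      |rowY k (2 * m + ε) + ε - rowY (i + 1) m'| ≤ 3 * 2 ^ (i - 1) → False := by
    intro i m' x' h hout
    obtain ⟨hi, hm', hx', hp', hy⟩ := id h
    have hd' : (bF i : ℤ) ∣ p + 1 := by rw [hp']; exact hx'.dvd.add dvd_rfl
    have hbi : (4 : ℤ) ≤ bF i := by exact_mod_cast four_le_bF i
    rcases lt_trichotomy i k with hik | rfl | hik
    · exact hx'.not_dvd_of_order_lt hi hik (p := p) (by linarith) (by linarith) hd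
    · rw [hr, abs_le] at hy
      rw [show rowY i (2 * m + ε) + ε - rowY (i + 1) m' =
        3 * 2 ^ (i - 1) * (2 * (m - m') + ε) + ε by rw [← hr]; ring, abs_le] at hout
      obtain ⟨a, rfl⟩ := hm
      obtain ⟨b, rfl⟩ := hm'
      rcases hε with rfl | rfl
      · have h3 : 2 * (2 * a + 1 - (2 * b + 1)) + 1 ≤ 0 := by
          by_contra hc
          nlinarith [hout.2]
        have h4 : -1 ≤ 2 * (2 * a + 1 - (2 * b + 1)) + 1 := by
          by_contra hc
          nlinarith [hy.1]
        omega
      · have h3 : 0 ≤ 2 * (2 * a + 1 - (2 * b + 1)) + -1 := by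
          by_contra hc
          nlinarith [hout.1]
        have h4 : 2 * (2 * a + 1 - (2 * b + 1)) + -1 ≤ 1 := by
          by_contra hc
          nlinarith [hy.2]
        omega
    · exact hx.not_dvd_of_order_lt hk hik (p := p) (by linarith) (by linarith) hd'
  ext u
  constructor
  · intro hu
    have hu : s(((p, rowY k (2 * m + ε)) : V), u) ∈ xiEdges := hu
    rcases neighbor_cases hu with rfl | rfl | rfl | rfl
    · exact absurd hd (not_dvd_of_horizontal hk hl hu)
    · exact Or.inl rfl
    · obtain ⟨i, m', x', h, h'⟩ := exists_abutment_of_up hu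
      rcases hε with rfl | rfl
      · exact (hvert _ _ _ h h').elim
      · right; simp
    · obtain ⟨i, m', x', h, h'⟩ := exists_abutment_of_down hu
      rcases hε with rfl | rfl
      · right; simp
      · exact (hvert _ _ _ h h').elim
  · have hrm := hr m
    rintro (rfl | rfl)
    · exact left_mem hk hl hx (by linarith) (by linarith)
    · rcases hε with rfl | rfl
      · exact (down_mem_iff _ _).mpr ((vertical_mem_iff _ _).mpr
          ⟨k, m, x, hk, hm, hx, hp, by linarith, by linarith⟩)
      · rw [show rowY k (2 * m + -1) - -1 = rowY k (2 * m + -1) + 1 by ring]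
        exact (vertical_mem_iff _ _).mpr ⟨k, m, x, hk, hm, hx, hp, by linarith, by linarith⟩

lemma neighbors_abutment {k : ℕ} {m x p y : ℤ} (hk : 1 ≤ k) (hm : Odd m)
    (hx : IsTip k x) (hp : p + 1 = x + bF k) (hne : y ≠ rowY (k + 1) m)
    (hy : |y - rowY (k + 1) m| < 3 * 2 ^ (k - 1)) :
    {u : V | s(((p, y) : V), u) ∈ xiEdges} = {(p, y + 1), (p, y - 1)} := by
  have hd : (bF k : ℤ) ∣ p + 1 := by rw [hp]; exact hx.dvd.add dvd_rfl
  have hrow : ∀ (i : ℕ) (l x' : ℤ), 1 ≤ i → IsTip i x' → y = rowY i l → x' ≤ p →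
      p + 1 ≤ x' + bF i → False := by
    intro i l x' hi hx' hyi h1 h2
    rcases lt_or_ge i k with hik | hik
    · exact hx'.not_dvd_of_order_lt hi hik h1 h2 hd
    · have hdvd : (3 * 2 ^ (k - 1) : ℤ) ∣ y - rowY (k + 1) m := by
        rw [hyi, rowY_eq_of_le hk hik, rowY_eq_of_le (i := k) (k := k + 1) hk (Nat.le_succ k)]
        exact (dvd_mul_right _ _).sub (dvd_mul_right _ _)
      exact hne (sub_eq_zero.mp (Int.eq_zero_of_abs_lt_dvd hdvd hy))
  rw [abs_lt] at hy
  ext u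
  constructor
  · intro hu
    have hu : s(((p, y) : V), u) ∈ xiEdges := hu
    rcases neighbor_cases hu with rfl | rfl | rfl | rfl
    · obtain ⟨i, l, x', hi, hl, hx', hyi, h1, h2⟩ := (horizontal_mem_iff _ _).mp hu
      exact (hrow i l x' hi hx' hyi h1 (by linarith)).elim
    · obtain ⟨i, l, x', hi, hl, hx', hyi, h1, h2⟩ :=
        (horizontal_mem_iff _ _).mp ((left_mem_iff _ _).mp hu)
      exact (hrow i l x' hi hx' hyi (by linarith) (by linarith)).elim
    · exact Or.inl rfl
    · exact Or.inr rfl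
  · rintro (rfl | rfl)
    · exact (vertical_mem_iff _ _).mpr ⟨k, m, x, hk, hm, hx, hp, by linarith, by linarith⟩
    · exact (down_mem_iff _ _).mpr ((vertical_mem_iff _ _).mpr
        ⟨k, m, x, hk, hm, hx, hp, by linarith, by linarith⟩)

end Geometry

section Costs

/-- Upper bound for the expected duration of the two excursions into the branches of order `k - 1`
attached at a root, together with the two steps entering them, for a branch of order `k`. -/
def loopCost (k : ℕ) : ℝ := (5 * 2 ^ (k - 1) - 4) * bF (k - 1)

/-- Bound for the expected time to go from the vertex at distance `p` of the tip, on the main part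
of a branch of order `k`, to its right neighbour. -/
def stepCost (β : ℝ) (k : ℕ) : ℕ → ℝ
  | 0 => 1
  | p + 1 => (β + 1 + (if bF (k - 1) ∣ p + 2 then loopCost k else 0) + stepCost β k p) / β

/-- Bound for the expected time to go from the vertex at distance `p` of the tip, on the main part
of a branch of order `k`, to the corner. -/
def rowCost (β : ℝ) (k p : ℕ) : ℝ := ∑ i ∈ Finset.Ico p (bF k - 1), stepCost β k i

/-- Bound for the expected time to descend from height `t`, on an abutment attached to a branch of
order `k`, to the root. -/
def climbCost (k t : ℕ) : ℝ := t * (loopCost k / 2 - 1) - t * (t - 1)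

lemma one_le_two_pow_real (k : ℕ) : (1 : ℝ) ≤ 2 ^ k := one_le_pow₀ (by norm_num)

lemma loopCost_nonneg (k : ℕ) : 0 ≤ loopCost k := by
  have := one_le_two_pow_real (k - 1)
  exact mul_nonneg (by linarith) (Nat.cast_nonneg _)

lemma stepCost_nonneg {β : ℝ} (hβ : 1 < β) (k p : ℕ) : 0 ≤ stepCost β k p := by
  induction p with
  | zero => exact zero_le_one
  | succ p ih =>
    have := loopCost_nonneg k
    rw [stepCost]
    split_ifs <;> positivity

lemma stepCost_le {β : ℝ} (hβ : 1 < β) (k p : ℕ) :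
    stepCost β k p ≤ 1 + 2 * p + ((p + 1) / bF (k - 1) : ℕ) * loopCost k := by
  have hc := loopCost_nonneg k
  induction p with
  | zero =>
    have : (0 : ℝ) ≤ ((0 + 1) / bF (k - 1) : ℕ) * loopCost k := by positivity
    rw [stepCost]; push_cast at *; linarith
  | succ p ih =>
    have h0 := stepCost_nonneg hβ k p
    rw [stepCost, div_le_iff₀ (by linarith), Nat.succ_div]
    set d : ℝ := ((p + 1) / bF (k - 1) : ℕ) * loopCost k with hd
    have hd0 : 0 ≤ d := by positivity
    have hp : (0 : ℝ) ≤ p := Nat.cast_nonneg p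
    split_ifs with h
    · have e : (((p + 1) / bF (k - 1) + 1 : ℕ) : ℝ) * loopCost k = d + loopCost k := by
        rw [hd]; push_cast; ring
      rw [e]; push_cast
      nlinarith
    · simp only [add_zero]; rw [← hd]; push_cast
      nlinarith

/-- The excursions into the attached branches cost at most `loopCost`. -/
lemma two_add_stepCost_le {β : ℝ} (hβ : 1 < β) {k : ℕ} (hk : 1 ≤ k) :
    2 + 4 * (3 * 2 ^ (k - 1)) + 2 * stepCost β k (bF k - 2) ≤ loopCost (k + 1) := by
  have h4 := four_le_bF k
  have h1 := stepCost_le hβ k (bF k - 2)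
  obtain ⟨n, rfl⟩ : ∃ n, k = n + 1 := ⟨k - 1, by omega⟩
  have hq : (bF (n + 1) - 2 + 1) / bF n = qF n := by
    have hpos := bF_pos n
    have := bF_succ_eq n
    rw [show bF (n + 1) - 2 + 1 = (bF n - 1) + qF n * bF n by omega,
      Nat.add_mul_div_right _ _ hpos, Nat.div_eq_of_lt (by omega), zero_add]
  rw [Nat.add_sub_cancel, hq, Nat.cast_sub (by omega)] at h1
  have hb : (bF (n + 1) : ℝ) = qF n * bF n + bF n := by exact_mod_cast bF_succ_eq n
  have hn4 : (4 : ℝ) ≤ bF n := by exact_mod_cast four_le_bF n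
  have h2 := one_le_two_pow_real n
  simp only [loopCost, Nat.add_sub_cancel] at h1 ⊢
  have h5 : (qF n : ℝ) * ((5 * 2 ^ n - 4) * bF n) = (5 * 2 ^ n - 4) * (bF (n + 1) - bF n) := by
    rw [hb]; ring
  rw [h5] at h1
  push_cast at h1 ⊢
  rw [pow_succ]
  nlinarith

lemma rowCost_nonneg {β : ℝ} (hβ : 1 < β) (k p : ℕ) : 0 ≤ rowCost β k p :=
  Finset.sum_nonneg fun i _ => stepCost_nonneg hβ k i

lemma rowCost_corner (β : ℝ) (k : ℕ) : rowCost β k (bF k - 1) = 0 := by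
  simp [rowCost]

lemma rowCost_eq (β : ℝ) {k p : ℕ} (hp : p + 2 ≤ bF k) :
    rowCost β k p = stepCost β k p + rowCost β k (p + 1) := by
  rw [rowCost, Finset.sum_eq_sum_Ico_succ_bot (by omega), rowCost]

lemma climbCost_zero (k : ℕ) : climbCost k 0 = 0 := by simp [climbCost]

lemma climbCost_nonneg {β : ℝ} (hβ : 1 < β) {k t : ℕ} (hk : 1 ≤ k) (ht : t ≤ 3 * 2 ^ (k - 1)) :
    0 ≤ climbCost (k + 1) t := by
  have h1 := two_add_stepCost_le hβ hk
  have h2 := stepCost_nonneg hβ k (bF k - 2)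
  have h3 : (t : ℝ) ≤ 3 * 2 ^ (k - 1) := by exact_mod_cast ht
  have h4 : (0 : ℝ) ≤ t := Nat.cast_nonneg t
  rw [climbCost, ← mul_sub]
  exact mul_nonneg h4 (by linarith)

lemma climbCost_interior (k t : ℕ) :
    2 + (climbCost k (t + 2) + climbCost k t) = 2 * climbCost k (t + 1) := by
  simp only [climbCost]; push_cast; ring

lemma climbCost_corner {β : ℝ} (hβ : 1 < β) {k t : ℕ} (hk : 1 ≤ k)
    (ht : t + 1 = 3 * 2 ^ (k - 1)) :
    2 + stepCost β k (bF k - 2) + climbCost (k + 1) t ≤ climbCost (k + 1) (t + 1) := by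
  have h1 := two_add_stepCost_le hβ hk
  have h3 : (t : ℝ) + 1 = 3 * 2 ^ (k - 1) := by exact_mod_cast ht
  simp only [climbCost]; push_cast
  nlinarith

lemma climbCost_one (k : ℕ) : climbCost k 1 = loopCost k / 2 - 1 := by simp [climbCost]

lemma stepCost_succ_mul {β : ℝ} (hβ : 1 < β) (k p : ℕ) :
    β * stepCost β k (p + 1) =
      β + 1 + (if bF (k - 1) ∣ p + 2 then loopCost k else 0) + stepCost β k p := by
  rw [stepCost, mul_div_cancel₀ _ (by linarith)]

/-- Along a main part the cost of a step is at most its value on a bare line plus a geometric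
contribution of the attached branches to the left. -/
lemma stepCost_le_geometric {β : ℝ} (hβ : 1 < β) (k p : ℕ) :
    stepCost β k p ≤ (β + 1) / (β - 1) + loopCost k *
      (β ^ (bF (k - 1) - 1 - (p + 1) % bF (k - 1)) / (β ^ bF (k - 1) - 1)) := by
  set b := bF (k - 1) with hb
  have hb4 : 4 ≤ b := four_le_bF _
  have hc := loopCost_nonneg k
  have hpow : 1 < β ^ b := one_lt_pow₀ hβ (by omega)
  have hβ1 : 0 < β - 1 := by linarith
  have hβ0 : 0 < β := by linarith
  have hG : 0 < β ^ b - 1 := by linarith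
  induction p with
  | zero =>
    have h1 : 1 ≤ (β + 1) / (β - 1) := by rw [le_div_iff₀ hβ1]; linarith
    have h2 : 0 ≤ loopCost k * (β ^ (b - 1 - (0 + 1) % b) / (β ^ b - 1)) := by positivity
    rw [stepCost]; linarith
  | succ p ih =>
    rw [stepCost, div_le_iff₀ hβ0, ← hb]
    have hU : (β + 1) / (β - 1) * β = β + 1 + (β + 1) / (β - 1) := by field_simp; ring
    have hlt : (p + 1) % b < b := Nat.mod_lt _ (by omega)
    by_cases h : b ∣ p + 2
    · have h0 : (p + 1 + 1) % b = 0 := Nat.mod_eq_zero_of_dvd h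
      have h1 : (p + 1) % b = b - 1 := by
        rw [Nat.add_mod, Nat.mod_eq_of_lt (show 1 < b by omega)] at h0
        by_contra hne
        rw [Nat.mod_eq_of_lt (by omega)] at h0
        omega
      rw [h1, Nat.sub_self, pow_zero] at ih
      rw [if_pos h, h0, Nat.sub_zero]
      have e : loopCost k * (β ^ (b - 1) / (β ^ b - 1)) * β =
          loopCost k + loopCost k * (1 / (β ^ b - 1)) := by
        have : β ^ b = β ^ (b - 1) * β := by rw [← pow_succ]; congr 1; omega
        field_simp
        rw [this]; ring
      rw [add_mul, hU, e]
      linarith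
    · have h0 : (p + 1 + 1) % b ≠ 0 := fun hc => h (Nat.dvd_of_mod_eq_zero hc)
      have h1 : (p + 1 + 1) % b = (p + 1) % b + 1 := by
        rw [Nat.add_mod, Nat.mod_eq_of_lt (show 1 < b by omega)] at h0 ⊢
        refine Nat.mod_eq_of_lt ?_
        by_contra hge
        exact h0 (by rw [show (p + 1) % b + 1 = b by omega, Nat.mod_self])
      have hlt' : (p + 1 + 1) % b < b := Nat.mod_lt _ (by omega)
      rw [if_neg h, h1]
      have e : loopCost k * (β ^ (b - 1 - ((p + 1) % b + 1)) / (β ^ b - 1)) * β =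
          loopCost k * (β ^ (b - 1 - (p + 1) % b) / (β ^ b - 1)) := by
        rw [show b - 1 - (p + 1) % b = b - 1 - ((p + 1) % b + 1) + 1 by omega, pow_succ]
        ring
      rw [add_mul, hU, e]
      linarith

lemma Cprime_eq {β : ℝ} (hβ : 1 < β) :
    Cprime β = (3 + β) / 2 * (β * (β + 1) / (β - 1) ^ 2) := by
  have hβ0 : 0 < β := by linarith
  have hβ1 : β - 1 ≠ 0 := by linarith
  have hs : ‖1 / β‖ < 1 := by
    rw [Real.norm_of_nonneg (by positivity), div_lt_one hβ0]; exact hβ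
  have h1 := hasSum_coe_mul_geometric_of_norm_lt_one hs
  have h2 := hasSum_geometric_of_norm_lt_one hs
  have h3 := (h1.mul_left 2).add h2
  have h4 : ∀ i : ℕ, 2 * ((i : ℝ) * (1 / β) ^ i) + (1 / β) ^ i =
      (2 * (i : ℝ) + 1) * (1 / β) ^ i := fun i => by ring
  simp only [h4] at h3
  rw [Cprime, h3.tsum_eq]
  congr 1
  have : 1 - 1 / β = (β - 1) / β := by field_simp
  rw [this]
  field_simp
  ring

lemma five_mul_two_pow_le (k : ℕ) : 5 * 2 ^ k ≤ 2 * bF k + 7 := by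
  rcases k with _ | _ | k
  · simp [bF]
  · simp [bF]
  induction k with
  | zero => simp [bF]
  | succ k ih =>
    have h3 : 3 ^ 2 ≤ 3 ^ (k + 1 + 1) := Nat.pow_le_pow_right (by norm_num) (by omega)
    have h4 := four_le_bF (k + 1 + 1)
    rw [bF_succ, pow_succ]
    nlinarith

/-- Second-order Bernoulli inequality. -/
lemma one_add_mul_add_le_pow {δ : ℝ} (hδ : 0 ≤ δ) (n : ℕ) :
    1 + n * δ + n * (n - 1) / 2 * δ ^ 2 ≤ (1 + δ) ^ n := by
  induction n with
  | zero => simp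
  | succ n ih =>
    have h1 : (0 : ℝ) ≤ n * (n - 1) := by
      rcases n with _ | n
      · simp
      · push_cast; rw [add_sub_cancel_right]; positivity
    have h2 : 0 ≤ n * (n - 1) * δ ^ 3 := by positivity
    rw [pow_succ (1 + δ)]
    push_cast
    nlinarith

theorem one_add_stepCost_le_Cprime {β : ℝ} (hβ : 1 < β) {k : ℕ} (hk : 1 ≤ k) :
    1 + stepCost β k (bF k - 2) ≤ Cprime β := by
  obtain ⟨n, rfl⟩ : ∃ n, k = n + 1 := ⟨k - 1, by omega⟩
  have h1 := stepCost_le_geometric hβ (n + 1) (bF (n + 1) - 2)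
  have hb4 := four_le_bF n
  have hmod : (bF (n + 1) - 2 + 1) % bF n = bF n - 1 := by
    have := bF_succ_eq n
    rw [show bF (n + 1) - 2 + 1 = (bF n - 1) + qF n * bF n by omega,
      Nat.add_mul_mod_self_right, Nat.mod_eq_of_lt (by omega)]
  rw [Nat.add_sub_cancel, hmod, Nat.sub_self, pow_zero, loopCost, Nat.add_sub_cancel] at h1
  rw [Cprime_eq hβ]
  obtain ⟨δ, rfl⟩ : ∃ δ, β = 1 + δ := ⟨β - 1, by ring⟩
  have hδ : 0 < δ := by linarith
  have hpow := one_add_mul_add_le_pow hδ.le (bF n)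
  have hfive : (5 : ℝ) * 2 ^ n ≤ 2 * bF n + 7 := by exact_mod_cast five_mul_two_pow_le n
  have hB : (4 : ℝ) ≤ bF n := by exact_mod_cast hb4
  set B : ℝ := (bF n : ℝ) with hBdef
  have hden : 0 < B * δ * (1 + (B - 1) * δ / 2) := by
    have : 0 < B - 1 := by linarith
    positivity
  have h2 : (5 * 2 ^ n - 4) * B * (1 / ((1 + δ) ^ bF n - 1)) ≤ 4 / δ ^ 2 + 5 / δ := by
    have h3 : 1 / ((1 + δ) ^ bF n - 1) ≤ 1 / (B * δ * (1 + (B - 1) * δ / 2)) :=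
      one_div_le_one_div_of_le hden (by nlinarith)
    have h4 := one_le_two_pow_real n
    calc (5 * 2 ^ n - 4) * B * (1 / ((1 + δ) ^ bF n - 1))
        ≤ (2 * B + 3) * B * (1 / (B * δ * (1 + (B - 1) * δ / 2))) := by
          have h5 : 0 ≤ 1 / (B * δ * (1 + (B - 1) * δ / 2)) := by positivity
          refine (mul_le_mul_of_nonneg_left h3 (by nlinarith)).trans ?_
          refine mul_le_mul_of_nonneg_right ?_ h5
          nlinarith
      _ ≤ 4 / δ ^ 2 + 5 / δ := by
          have hB1 : 0 < B - 1 := by linarith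
          have e : 4 / δ ^ 2 + 5 / δ = (4 + 5 * δ) / δ ^ 2 := by field_simp
          rw [e, mul_one_div, div_le_div_iff₀ hden (by positivity)]
          have : 0 ≤ B * δ * (4 + (B - 1) * δ ^ 2 * 5 / 2) := by positivity
          nlinarith
  have h6 : (3 + (1 + δ)) / 2 * ((1 + δ) * (1 + δ + 1) / (1 + δ - 1) ^ 2) =
      4 / δ ^ 2 + 7 / δ + 7 / 2 + δ / 2 := by
    rw [add_sub_cancel_left]; field_simp; ring
  have h7 : (1 + δ + 1) / (1 + δ - 1) = 1 + 2 / δ := by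
    rw [add_sub_cancel_left]; field_simp; ring
  have h8 : 7 / δ = 5 / δ + 2 / δ := by ring
  rw [h6]
  rw [h7] at h1
  linarith

end Costs

section Potential

/-- `SubBranch β K L X k l x o`: the branch of order `k` with tip `x` in the row of index `l` is
the branch `(K, L, X)`, or is attached to it through a chain of branches of decreasing orders;
the expected time from its corner to the corner of `(K, L, X)` is bounded by `o`. -/
inductive SubBranch (β : ℝ) (K : ℕ) (L X : ℤ) : ℕ → ℤ → ℤ → ℝ → Prop
  | self : SubBranch β K L X K L X 0
  | attached (k : ℕ) (m x x' ε : ℤ) (p : ℕ) (o : ℝ) : SubBranch β K L X (k + 1) m x o →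
      1 ≤ k → IsTip k x' → (ε = 1 ∨ ε = -1) → p + 2 ≤ bF (k + 1) →
      x + p + 1 = x' + bF k →
      SubBranch β K L X k (2 * m + ε) x'
        (o + rowCost β (k + 1) p + climbCost (k + 1) (3 * 2 ^ (k - 1)))

/-- `Potential β K L X v r`: the vertex `v` is to the left of the corner of the branch
`(K, L, X)` and the expected time to go from `v` to that corner is bounded by `r`. -/
inductive Potential (β : ℝ) (K : ℕ) (L X : ℤ) : V → ℝ → Prop
  | main (k : ℕ) (l x z : ℤ) (p : ℕ) (o : ℝ) : SubBranch β K L X k l x o → p + 1 ≤ bF k →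
      z = x + p → Potential β K L X (z, rowY k l) (o + rowCost β k p)
  | abutment (k : ℕ) (m x x' ε z y : ℤ) (p t : ℕ) (o : ℝ) : SubBranch β K L X (k + 1) m x o →
      1 ≤ k → IsTip k x' → (ε = 1 ∨ ε = -1) → p + 2 ≤ bF (k + 1) →
      x + p + 1 = x' + bF k → 0 < t → t < 3 * 2 ^ (k - 1) → z = x + p →
      y = rowY (k + 1) m + ε * t →
      Potential β K L X (z, y) (o + rowCost β (k + 1) p + climbCost (k + 1) t)

variable {β : ℝ} {K : ℕ} {L X : ℤ}

lemma rowY_attached {k : ℕ} (hk : 1 ≤ k) (m ε : ℤ) :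
    rowY k (2 * m + ε) = rowY (k + 1) m + ε * (3 * 2 ^ (k - 1)) := by
  rw [rowY_eq_of_le (i := k) (k := k + 1) hk (Nat.le_succ k), rowY,
    show k + 1 - k = 1 by omega]; ring

lemma SubBranch.isBranch (hK : 1 ≤ K) (hL : Odd L) (hX : IsTip K X) {k : ℕ} {l x : ℤ} {o : ℝ}
    (h : SubBranch β K L X k l x o) : 1 ≤ k ∧ Odd l ∧ IsTip k x := by
  cases h with
  | self => exact ⟨hK, hL, hX⟩
  | attached k m x x' ε p o _ hk hx' hε _ _ =>
    refine ⟨hk, ?_, hx'⟩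
    rcases hε with rfl | rfl
    · exact ⟨m, rfl⟩
    · exact ⟨m - 1, by ring⟩

lemma SubBranch.nonneg (hβ : 1 < β) {k : ℕ} {l x : ℤ} {o : ℝ}
    (h : SubBranch β K L X k l x o) : 0 ≤ o := by
  induction h with
  | self => exact le_rfl
  | attached k m x x' ε p o _ hk _ _ _ _ ih =>
    have h1 := rowCost_nonneg hβ (k + 1) p
    have h2 := climbCost_nonneg hβ hk le_rfl
    linarith

lemma Potential.nonneg (hβ : 1 < β) {v : V} {r : ℝ} (h : Potential β K L X v r) : 0 ≤ r := by
  cases h with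
  | main k l x z p o hb _ _ => exact add_nonneg (hb.nonneg hβ) (rowCost_nonneg hβ k p)
  | abutment k m x x' ε z y p t o hb hk _ _ _ _ _ ht _ _ =>
    have h1 := rowCost_nonneg hβ (k + 1) p
    have h2 := climbCost_nonneg hβ hk ht.le
    have h3 := hb.nonneg hβ
    linarith

lemma Potential.climb {k : ℕ} {m x x' ε z y : ℤ} {p t : ℕ} {o : ℝ}
    (hb : SubBranch β K L X (k + 1) m x o) (hk : 1 ≤ k) (hx' : IsTip k x')
    (hε : ε = 1 ∨ ε = -1) (hp : p + 2 ≤ bF (k + 1)) (hxp : x + p + 1 = x' + bF k)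
    (ht : t ≤ 3 * 2 ^ (k - 1)) (hz : z = x + p) (hy : y = rowY (k + 1) m + ε * t) :
    Potential β K L X (z, y) (o + rowCost β (k + 1) p + climbCost (k + 1) t) := by
  have h4 := four_le_bF k
  rcases Nat.eq_zero_or_pos t with rfl | ht0
  · have := Potential.main (β := β) _ _ _ z p _ hb (by omega) hz
    rw [climbCost_zero, add_zero, hy]
    simpa using this
  rcases Nat.lt_or_ge t (3 * 2 ^ (k - 1)) with hlt | hge
  · exact .abutment k m x x' ε z y p t o hb hk hx' hε hp hxp ht0 hlt hz hy
  · obtain rfl : t = 3 * 2 ^ (k - 1) := le_antisymm ht hge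
    have := Potential.main _ _ _ z (bF k - 1) _
      (SubBranch.attached k m x x' ε p o hb hk hx' hε hp hxp) (by omega) (by omega)
    rw [rowCost_corner, add_zero, rowY_attached hk] at this
    rw [hy]
    exact_mod_cast this

/-- The best available bound for the expected time to the corner (`⊤` off the left of it). -/
def minPotential (β : ℝ) (K : ℕ) (L X : ℤ) (v : V) : ℝ≥0∞ :=
  ⨅ (r : ℝ) (_ : Potential β K L X v r), ENNReal.ofReal r

lemma Potential.bound (hβ : 1 < β) {v : V} {r : ℝ} (h : Potential β K L X v r) :
    0 ≤ r ∧ minPotential β K L X v ≤ ENNReal.ofReal r :=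
  ⟨h.nonneg hβ, iInf₂_le r h⟩

lemma exists_attached_tip {k q : ℕ} {x : ℤ} (hx : IsTip (k + 1) x) (hq : q + 1 < bF (k + 1))
    (hd : bF k ∣ q + 1) : ∃ x', IsTip k x' ∧ x + q + 1 = x' + bF k := by
  obtain ⟨j, hj⟩ := hd
  have hb := bF_succ_eq k
  have hpos := bF_pos k
  have hj1 : 1 ≤ j := by
    rcases j with _ | j
    · simp at hj
    · omega
  have hj2 : j ≤ qF k := by
    have : bF k * j < bF k * (qF k + 1) := by rw [← hj]; linarith
    have := lt_of_mul_lt_mul_left this (Nat.zero_le _)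
    omega
  have hj' : (q : ℤ) + 1 = bF k * j := by exact_mod_cast hj
  exact ⟨_, IsTip.step k x j hx hj1 hj2, by linear_combination hj'⟩

lemma minPotential_step_main (hβ : 1 < β) (hK : 1 ≤ K) (hL : Odd L) (hX : IsTip K X) {k : ℕ}
    {l x : ℤ} {p : ℕ} {o : ℝ} (hb : SubBranch β K L X k l x o) (hp : p + 2 ≤ bF k) :
    1 + ∑' w, ENNReal.ofReal (transProb β xiEdges (x + p, rowY k l) w) *
      minPotential β K L X w ≤ ENNReal.ofReal (o + rowCost β k p) := by
  obtain ⟨hk, hl, hx⟩ := hb.isBranch hK hL hX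
  have hright : Potential β K L X (x + p + 1, rowY k l) (o + rowCost β k (p + 1)) :=
    .main k l x _ (p + 1) o hb (by omega) (by push_cast; ring)
  have hrow := rowCost_eq β hp
  rcases p with _ | q
  · have hN := neighbors_tip hk hl hx
    simp only [Nat.cast_zero, add_zero] at hright ⊢
    refine one_add_tsum_le_right hβ hN (hright.bound hβ) ?_
    rw [hrow, stepCost]; linarith
  have hleft : Potential β K L X (x + (q + 1 : ℕ) - 1, rowY k l) (o + rowCost β k q) :=
    .main k l x _ q o hb (by omega) (by push_cast; ring)
  have hrow' := rowCost_eq β (k := k) (p := q) (by omega)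
  have hstep := stepCost_succ_mul hβ k q
  have hp' : x + ((q + 1 : ℕ) : ℤ) + 2 ≤ x + bF k := by
    have : (((q + 1) + 2 : ℕ) : ℤ) ≤ bF k := by exact_mod_cast hp
    push_cast at this ⊢; linarith
  have hq0 : x < x + ((q + 1 : ℕ) : ℤ) := by push_cast; linarith
  by_cases hd : bF (k - 1) ∣ q + 2
  · rcases k with _ | _ | k
    · omega
    · have := Nat.le_of_dvd (by omega) hd
      have : bF (0 + 1) = bF 0 := rfl
      simp only [Nat.add_sub_cancel] at *
      omega
    simp only [Nat.add_sub_cancel] at hd hstep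
    obtain ⟨x', hx', hxp⟩ := exists_attached_tip (q := q + 1) hx (by omega) hd
    have hN := neighbors_root (by omega) hl hx hq0 hp' hx' hxp
    have hL1 : 1 ≤ 3 * 2 ^ (k + 1 - 1) := by
      have : 0 < 2 ^ (k + 1 - 1) := by positivity
      omega
    have hup : Potential β K L X (x + (q + 1 : ℕ), rowY (k + 1 + 1) l + 1)
        (o + rowCost β (k + 1 + 1) (q + 1) + climbCost (k + 1 + 1) 1) :=
      .climb hb (by omega) hx' (Or.inl rfl) hp hxp hL1 rfl (by simp)
    have hdown : Potential β K L X (x + (q + 1 : ℕ), rowY (k + 1 + 1) l - 1)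
        (o + rowCost β (k + 1 + 1) (q + 1) + climbCost (k + 1 + 1) 1) :=
      .climb hb (by omega) hx' (Or.inr rfl) hp hxp hL1 rfl (by simp; ring)
    refine one_add_tsum_le_cross hβ hN (hright.bound hβ) (hleft.bound hβ) (hup.bound hβ)
      (hdown.bound hβ).2 ?_
    rw [if_pos hd] at hstep
    rw [climbCost_one, hrow', hrow]
    linarith
  · have hd' : ¬ (bF (k - 1) : ℤ) ∣ x + ((q + 1 : ℕ) : ℤ) + 1 := by
      intro hc
      have h1 : (bF (k - 1) : ℤ) ∣ x :=
        dvd_trans (by exact_mod_cast bF_dvd_bF (Nat.sub_le k 1)) hx.dvd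
      rw [add_assoc, dvd_add_right h1] at hc
      exact hd (by exact_mod_cast hc)
    have hN := neighbors_plain hk hl hx hq0 hp' hd'
    refine one_add_tsum_le_right_left hβ hN (hright.bound hβ) (hleft.bound hβ) ?_
    rw [if_neg hd] at hstep
    rw [hrow', hrow]
    linarith

lemma minPotential_step_corner (hβ : 1 < β) (hK : 1 ≤ K) (hL : Odd L) (hX : IsTip K X) {k : ℕ}
    {m x x' ε : ℤ} {p : ℕ} {o : ℝ} (hb : SubBranch β K L X (k + 1) m x o) (hk : 1 ≤ k)
    (hx' : IsTip k x') (hε : ε = 1 ∨ ε = -1) (hp : p + 2 ≤ bF (k + 1))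
    (hxp : x + p + 1 = x' + bF k) :
    1 + ∑' w, ENNReal.ofReal (transProb β xiEdges (x + p, rowY k (2 * m + ε)) w) *
      minPotential β K L X w ≤
        ENNReal.ofReal (o + rowCost β (k + 1) p + climbCost (k + 1) (3 * 2 ^ (k - 1))) := by
  obtain ⟨-, hm, -⟩ := hb.isBranch hK hL hX
  have h4 := four_le_bF k
  have hN := neighbors_corner hk hm hε hx' hxp
  obtain ⟨t, ht⟩ : ∃ t, t + 1 = 3 * 2 ^ (k - 1) := by
    have : 0 < 2 ^ (k - 1) := by positivity
    exact ⟨3 * 2 ^ (k - 1) - 1, by omega⟩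
  have ht' : (t : ℤ) + 1 = 3 * 2 ^ (k - 1) := by exact_mod_cast ht
  have hvert : Potential β K L X (x + p, rowY k (2 * m + ε) - ε)
      (o + rowCost β (k + 1) p + climbCost (k + 1) t) :=
    .climb hb hk hx' hε hp hxp (by omega) rfl (by
      rw [rowY_attached hk, ← ht']; ring)
  have hleft := Potential.main _ _ _ (x + p - 1) (bF k - 2) _
    (SubBranch.attached k m x x' ε p o hb hk hx' hε hp hxp) (by omega) (by omega)
  rw [rowCost_eq β (k := k) (p := bF k - 2) (by omega), show bF k - 2 + 1 = bF k - 1 by omega,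
    rowCost_corner] at hleft
  have hc := climbCost_corner hβ hk ht
  have hε0 : ε ≠ 0 := by rcases hε with rfl | rfl <;> norm_num
  rw [← ht] at hleft ⊢
  refine one_add_tsum_le_pair hβ ?_ hN ?_ ?_ (hleft.bound hβ) (hvert.bound hβ) ?_
  · simp [Prod.ext_iff]
  · simp [Prod.ext_iff]; omega
  · simp [Prod.ext_iff]
  · linarith

lemma minPotential_step_abutment (hβ : 1 < β) (hK : 1 ≤ K) (hL : Odd L) (hX : IsTip K X) {k : ℕ}
    {m x x' ε : ℤ} {p t : ℕ} {o : ℝ} (hb : SubBranch β K L X (k + 1) m x o) (hk : 1 ≤ k)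
    (hx' : IsTip k x') (hε : ε = 1 ∨ ε = -1) (hp : p + 2 ≤ bF (k + 1))
    (hxp : x + p + 1 = x' + bF k) (ht : t + 1 < 3 * 2 ^ (k - 1)) :
    1 + ∑' w, ENNReal.ofReal
      (transProb β xiEdges (x + p, rowY (k + 1) m + ε * (t + 1 : ℕ)) w) *
      minPotential β K L X w ≤
        ENNReal.ofReal (o + rowCost β (k + 1) p + climbCost (k + 1) (t + 1)) := by
  obtain ⟨-, hm, -⟩ := hb.isBranch hK hL hX
  have ht' : (t : ℤ) + 1 < 3 * 2 ^ (k - 1) := by exact_mod_cast ht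
  have hfar : Potential β K L X (x + p, rowY (k + 1) m + ε * (t + 2 : ℕ))
      (o + rowCost β (k + 1) p + climbCost (k + 1) (t + 2)) :=
    .climb hb hk hx' hε hp hxp (by omega) rfl rfl
  have hnear : Potential β K L X (x + p, rowY (k + 1) m + ε * t)
      (o + rowCost β (k + 1) p + climbCost (k + 1) t) :=
    .climb hb hk hx' hε hp hxp (by omega) rfl rfl
  have hN := neighbors_abutment (y := rowY (k + 1) m + ε * (t + 1 : ℕ)) hk hm hx' hxp
    (by rcases hε with rfl | rfl <;> push_cast <;> omega)
    (by rw [add_sub_cancel_left, abs_lt]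
        rcases hε with rfl | rfl <;> push_cast <;> constructor <;> linarith)
  have hc := climbCost_interior (k + 1) t
  have hne : ((x + p, rowY (k + 1) m + ε * (t + 1 : ℕ) + 1) : V) ≠
      (x + p, rowY (k + 1) m + ε * (t + 1 : ℕ) - 1) := by
    simp [Prod.ext_iff]; omega
  rcases hε with rfl | rfl
  · have e1 : rowY (k + 1) m + 1 * ((t + 1 : ℕ) : ℤ) + 1 =
      rowY (k + 1) m + 1 * ((t + 2 : ℕ) : ℤ) := by push_cast; ring
    have e2 : rowY (k + 1) m + 1 * ((t + 1 : ℕ) : ℤ) - 1 = rowY (k + 1) m + 1 * (t : ℤ) := by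
      push_cast; ring
    rw [← e1] at hfar
    rw [← e2] at hnear
    refine one_add_tsum_le_pair hβ hne hN ?_ ?_ (hfar.bound hβ) (hnear.bound hβ) ?_
    · simp [Prod.ext_iff]
    · simp [Prod.ext_iff]
    · linarith
  · have e1 : rowY (k + 1) m + -1 * ((t + 1 : ℕ) : ℤ) - 1 =
      rowY (k + 1) m + -1 * ((t + 2 : ℕ) : ℤ) := by push_cast; ring
    have e2 : rowY (k + 1) m + -1 * ((t + 1 : ℕ) : ℤ) + 1 = rowY (k + 1) m + -1 * (t : ℤ) := by
      push_cast; ring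
    rw [← e1] at hfar
    rw [← e2] at hnear
    refine one_add_tsum_le_pair hβ hne hN ?_ ?_ (hnear.bound hβ) (hfar.bound hβ) ?_
    · simp [Prod.ext_iff]
    · simp [Prod.ext_iff]
    · linarith

theorem minPotential_superharmonic (hβ : 1 < β) (hK : 1 ≤ K) (hL : Odd L) (hX : IsTip K X)
    (v : V) (hv : v ≠ (X + bF K - 1, rowY K L)) :
    1 + ∑' w, ENNReal.ofReal (transProb β xiEdges v w) * minPotential β K L X w ≤
      minPotential β K L X v := by
  refine le_iInf₂ fun r hr => ?_
  cases hr with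
  | main k l x z p o hb hp hz =>
    subst hz
    rcases Nat.lt_or_ge (p + 1) (bF k) with hlt | hge
    · exact minPotential_step_main hβ hK hL hX hb hlt
    obtain rfl : p = bF k - 1 := by omega
    have h4 := four_le_bF k
    cases hb with
    | self =>
      refine absurd ?_ hv
      ext
      · simp only; omega
      · rfl
    | attached _ m x₁ _ ε q o hb hk hx' hε hq hxp =>
      rw [rowCost_corner, add_zero, show x + ((bF k - 1 : ℕ) : ℤ) = x₁ + q by omega]
      exact minPotential_step_corner hβ hK hL hX hb hk hx' hε hq hxp
  | abutment k m x x' ε z y p t o hb hk hx' hε hp hxp ht0 ht hz hy =>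
    subst hz hy
    obtain ⟨s, rfl⟩ : ∃ s, t = s + 1 := ⟨t - 1, by omega⟩
    exact minPotential_step_abutment hβ hK hL hX hb hk hx' hε hp hxp ht

end Potential

/-- Lemma 4.4 (a). A β-biased walk on ξ taking a step to the left from the corner point of
an order-`k` branch returns to the corner in expected time at most `C'_β`: one plus the
expected hitting time of the corner for the walk started at its left neighbour is at most
`C'_β`. -/
theorem excursion_left_of_corner (β : ℝ) (hβ : 1 < β) (k : ℕ) (hk : 1 ≤ k)
    (l x : ℤ) (hl : Odd l) (hx : IsTip k x) (μ : Measure (ℕ → V))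
    (hμ : IsWalkLaw β xiEdges ((x + bF k - 2, rowY k l) : V) μ) :
    1 + ∫⁻ ω, (hitTime ω ((x + bF k - 1, rowY k l) : V) : ℝ≥0∞) ∂μ ≤
      ENNReal.ofReal (Cprime β) := by
  have h4 := four_le_bF k
  have hstart : Potential β k l x (x + bF k - 2, rowY k l) (stepCost β k (bF k - 2)) := by
    have h := Potential.main (β := β) _ _ _ (x + bF k - 2) (bF k - 2) _
      (SubBranch.self (K := k) (L := l) (X := x)) (by omega) (by omega)
    rwa [rowCost_eq β (by omega), show bF k - 2 + 1 = bF k - 1 by omega, rowCost_corner,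
      add_zero, zero_add] at h
  calc 1 + ∫⁻ ω, (hitTime ω ((x + bF k - 1, rowY k l) : V) : ℝ≥0∞) ∂μ
      ≤ 1 + ENNReal.ofReal (stepCost β k (bF k - 2)) := by
        gcongr
        exact (lintegral_hitTime_le hβ hμ _ _
          (minPotential_superharmonic hβ hk hl hx)).trans (hstart.bound hβ).2
    _ = ENNReal.ofReal (1 + stepCost β k (bF k - 2)) := by
        rw [ENNReal.ofReal_add zero_le_one (stepCost_nonneg hβ _ _), ENNReal.ofReal_one]
    _ ≤ ENNReal.ofReal (Cprime β) :=
        ENNReal.ofReal_le_ofReal (one_add_stepCost_le_Cprime hβ hk)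

end
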